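/- Let F be a field, f ∈ F[X₁,…,Xₙ] non-constant, and g ∈ F[Y] a non-constant univariate polynomial that is square-free over the algebraic closure of F, with g(1) ≠ 0 and g′(1) ≠ 0. Then G(X,Y) = g(Y)·(1 + f(X)) − g(1) is absolutely irreducible, and for every root x of f, the point (x,1) is a non-singular point of the hypersurface G = 0 (that is, G(x,1) = 0 and some partial derivative of G does not vanish at (x,1)). -/

import Mathlib

open MvPolynomial in
/-- Polynomials which become units modulo a prime `p` have all nonconstant coefficients
divisible by `p`. -/
theorem MvPolynomial.dvd_coeff_of_isUnit_map_mk {R σ : Type*} [CommRing R] {p : R}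
    (hp : Prime p) {a : MvPolynomial σ R}
    (ha : IsUnit (map (Ideal.Quotient.mk (Ideal.span {p})) a))
    {d : σ →₀ ℕ} (hd : d ≠ 0) : p ∣ a.coeff d := by
  have : (Ideal.span {p}).IsPrime := (Ideal.span_singleton_prime hp.ne_zero).2 hp
  have h := ((MvPolynomial.isUnit_iff (P := map _ a)).1 ha).2 d hd
  rw [isNilpotent_iff_eq_zero, coeff_map, Ideal.Quotient.eq_zero_iff_dvd] at h
  exact h

namespace MonomialOrder

open MvPolynomial

variable {R σ : Type*} [CommRing R] (m : MonomialOrder σ)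

/-- A constant divisor of `g f - c` is a unit if `c` is a unit and the leading coefficient
of the nonconstant polynomial `f` is a unit. -/
theorem isUnit_of_C_dvd_C_mul_sub_C {g c r : R} {f : MvPolynomial σ R} (hc : IsUnit c)
    (hf : IsUnit (m.leadingCoeff f)) (hfd : m.degree f ≠ 0)
    (hr : C r ∣ C g * f - C c) : IsUnit r := by
  classical
  rw [C_dvd_iff_dvd_coeff] at hr
  have hg : r ∣ g := by
    have h := hr (m.degree f)
    rw [coeff_sub, coeff_C_mul, coeff_C, if_neg hfd.symm, sub_zero] at h
    exact hf.dvd_mul_right.1 h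
  have h0 := hr 0
  rw [coeff_sub, coeff_C_mul, coeff_zero_C] at h0
  exact isUnit_of_dvd_unit ((dvd_sub_right (hg.mul_right _)).1 h0) hc

/-- An Eisenstein-type criterion at the leading coefficient. -/
theorem irreducible_C_mul_sub_C [IsDomain R] {g c p : R} {f : MvPolynomial σ R} (hp : Prime p)
    (hpg : p ∣ g) (hpg2 : ¬ p * p ∣ g) (hc : IsUnit c)
    (hf : IsUnit (m.leadingCoeff f)) (hfd : m.degree f ≠ 0) :
    Irreducible (C g * f - C c) := by
  have hg0 : g ≠ 0 := by rintro rfl; exact hpg2 (dvd_zero _)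
  have hf0 : f ≠ 0 := by rintro rfl; simp at hfd
  have hdeg : m.degree (C g * f) = m.degree f := by
    rw [m.degree_mul (by simpa using hg0) hf0, degree_C, zero_add]
  have hlt : m.toSyn (m.degree (C c : MvPolynomial σ R)) < m.toSyn (m.degree (C g * f)) := by
    rw [hdeg, degree_C, map_zero]
    exact m.toSyn_lt_iff_ne_zero.2 (m.toSyn.map_ne_zero_iff.2 hfd)
  have hlc : m.leadingCoeff (C g * f - C c) = g * m.leadingCoeff f := by
    rw [m.leadingCoeff_sub_of_lt hlt, leadingCoeff_mul, leadingCoeff_C]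
  have hd : m.degree (C g * f - C c) = m.degree f := by
    rw [m.degree_sub_of_lt hlt, hdeg]
  refine ⟨fun hu => ?_, fun a b hab => ?_⟩
  · rw [isUnit_iff_eq_C_of_isReduced] at hu
    obtain ⟨r, -, hr⟩ := hu
    rw [hr, degree_C] at hd
    exact hfd hd.symm
  have hunit : IsUnit (map (Ideal.Quotient.mk (Ideal.span {p})) a *
      map (Ideal.Quotient.mk (Ideal.span {p})) b) := by
    rw [← map_mul, ← hab, map_sub, map_mul, map_C, map_C,
      Ideal.Quotient.eq_zero_iff_dvd _ _ |>.2 hpg, C_0, zero_mul, zero_sub]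
    exact IsUnit.neg ((hc.map (Ideal.Quotient.mk (Ideal.span {p}))).map C)
  have key : m.degree a = 0 ∨ m.degree b = 0 := by
    by_contra! h
    have ha := MvPolynomial.dvd_coeff_of_isUnit_map_mk hp (isUnit_of_mul_isUnit_left hunit) h.1
    have hb := MvPolynomial.dvd_coeff_of_isUnit_map_mk hp (isUnit_of_mul_isUnit_right hunit) h.2
    have h2 := mul_dvd_mul ha hb
    change _ ∣ m.leadingCoeff a * m.leadingCoeff b at h2
    rw [← leadingCoeff_mul, ← hab, hlc] at h2
    exact hpg2 (hf.dvd_mul_right.1 h2)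
  refine key.imp (fun h => ?_) (fun h => ?_)
  · rw [m.eq_C_of_degree_eq_zero h] at hab ⊢
    exact (m.isUnit_of_C_dvd_C_mul_sub_C hc hf hfd ⟨_, hab⟩).map _
  · rw [m.eq_C_of_degree_eq_zero h] at hab ⊢
    exact (m.isUnit_of_C_dvd_C_mul_sub_C hc hf hfd ⟨_, hab.trans (mul_comm _ _)⟩).map _

end MonomialOrder

open MvPolynomial in
/-- If `f` is nonconstant, `g` is nonconstant and squarefree over an algebraically closed field
and `c ≠ 0`, then `g(Y) f(X) - c` is irreducible. -/
theorem MvPolynomial.irreducible_aeval_inr_mul_rename_inl_sub_C {K : Type*} [Field K]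
    [IsAlgClosed K] {n : ℕ} {f : MvPolynomial (Fin n) K} {g : Polynomial K} {c : K}
    (hf : f.totalDegree ≠ 0) (hg : g.natDegree ≠ 0) (hsf : Squarefree g) (hc : c ≠ 0) :
    Irreducible (Polynomial.aeval (X (Sum.inr ()) : MvPolynomial (Fin n ⊕ Unit) K) g *
      rename (Sum.inl : Fin n → Fin n ⊕ Unit) f - C c) := by
  let e := (sumAlgEquiv K (Fin n) Unit).trans (mapAlgEquiv (Fin n) (uniqueAlgEquiv K Unit))
  have heg : e (Polynomial.aeval (X (Sum.inr ())) g) = C g := by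
    have hX : e (X (Sum.inr ())) = C Polynomial.X := by
      simp [e]
    have hC : (C Polynomial.X : MvPolynomial (Fin n) (Polynomial K)) =
        IsScalarTower.toAlgHom K (Polynomial K) (MvPolynomial (Fin n) (Polynomial K))
          Polynomial.X := rfl
    rw [← Polynomial.aeval_algHom_apply, hX, hC, Polynomial.aeval_algHom_apply,
      Polynomial.aeval_X_left_apply]
    rfl
  have hef : e (rename Sum.inl f) = map Polynomial.C f := by
    have : e.toAlgHom.comp (rename Sum.inl) =
        mapAlgHom (Polynomial.CAlgHom (R := K) (A := K)) := by
      ext i : 1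
      simp [e]
    exact DFunLike.congr_fun this f
  have hec : e (C c) = C (Polynomial.C c) := by
    exact e.commutes c
  rw [← MulEquiv.irreducible_iff e, map_sub, map_mul, heg, hef, hec]
  obtain ⟨y, hy⟩ := IsAlgClosed.exists_root g
    (fun h => hg (Polynomial.natDegree_eq_of_degree_eq_some h))
  have hp := Polynomial.prime_X_sub_C y
  let m : MonomialOrder (Fin n) := MonomialOrder.lex
  have hdeg : m.degree (map Polynomial.C f) = m.degree f := by
    simp only [MonomialOrder.degree, support_map_of_injective f Polynomial.C_injective]
  have hfd : m.degree f ≠ 0 := by rwa [Ne, m.degree_eq_zero_iff_totalDegree_eq_zero]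
  refine m.irreducible_C_mul_sub_C hp (Polynomial.dvd_iff_isRoot.2 hy)
    (fun h => hp.not_isUnit (hsf _ h)) ((Ne.isUnit hc).map _) ?_ (by rwa [hdeg])
  rw [MonomialOrder.leadingCoeff, hdeg, coeff_map]
  refine IsUnit.map _ (Ne.isUnit ?_)
  rw [Ne, m.coeff_degree_eq_zero_iff]
  rintro rfl
  simp at hf

/-- For `f ∈ F[X₁,…,Xₙ]` non-constant and `g ∈ F[Y]` non-constant,
square-free over the algebraic closure of `F`, with `g(1) ≠ 0` and `g′(1) ≠ 0`,
the polynomial `G(X,Y) = g(Y)·(1 + f(X)) − g(1)` is absolutely irreducible, and for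
every root `x` of `f` the point `(x,1)` is a non-singular point of the hypersurface
`G = 0` (i.e. `G(x,1) = 0` and some partial derivative of `G` is nonzero there). -/
theorem nonsingular_absolutely_irreducible {F : Type*} [Field F] {n : ℕ}
    (f : MvPolynomial (Fin n) F) (g : Polynomial F)
    (hf : 0 < f.totalDegree) (hg : 0 < g.natDegree)
    (hsf : Squarefree (g.map (algebraMap F (AlgebraicClosure F))))
    (hg1 : g.eval 1 ≠ 0) (hg1' : g.derivative.eval 1 ≠ 0)
    (G : MvPolynomial (Fin n ⊕ Unit) F)
    (hG : G = (Polynomial.aeval (MvPolynomial.X (Sum.inr ()) : MvPolynomial (Fin n ⊕ Unit) F) g) *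
        (1 + MvPolynomial.rename (Sum.inl : Fin n → Fin n ⊕ Unit) f)
        - MvPolynomial.C (g.eval 1)) :
    Irreducible (MvPolynomial.map (algebraMap F (AlgebraicClosure F)) G) ∧
      ∀ x : Fin n → F, MvPolynomial.eval x f = 0 →
        MvPolynomial.eval (Sum.elim x fun _ => (1 : F)) G = 0 ∧
          ∃ i, MvPolynomial.eval (Sum.elim x fun _ => (1 : F)) (MvPolynomial.pderiv i G) ≠ 0 := by
  subst hG
  have heval (x : Fin n → F) (q : Polynomial F) :
      MvPolynomial.eval (Sum.elim x fun _ => (1 : F))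
        (Polynomial.aeval (MvPolynomial.X (Sum.inr ())) q) = q.eval 1 := by
    rw [← MvPolynomial.coe_aeval_eq_eval, RingHom.coe_coe, ← Polynomial.aeval_algHom_apply]
    simp
  refine ⟨?_, fun x hx => ⟨?_, Sum.inr (), ?_⟩⟩
  · have hmap : MvPolynomial.map (algebraMap F (AlgebraicClosure F))
        (Polynomial.aeval (MvPolynomial.X (Sum.inr ()) : MvPolynomial (Fin n ⊕ Unit) F) g) =
        Polynomial.aeval (MvPolynomial.X (Sum.inr ()))
          (g.map (algebraMap F (AlgebraicClosure F))) := by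
      rw [Polynomial.aeval_map_algebraMap, Polynomial.aeval_def, Polynomial.hom_eval₂,
        MvPolynomial.map_X, Polynomial.aeval_def]
      congr 1
      ext1 r
      exact MvPolynomial.map_C _ r
    have h1 : (1 : MvPolynomial (Fin n ⊕ Unit) (AlgebraicClosure F)) +
        MvPolynomial.rename Sum.inl (MvPolynomial.map (algebraMap F (AlgebraicClosure F)) f) =
        MvPolynomial.rename Sum.inl
          (MvPolynomial.map (algebraMap F (AlgebraicClosure F)) (MvPolynomial.C 1 + f)) := by
      simp
    rw [map_sub, map_mul, map_add, map_one, MvPolynomial.map_C, hmap, MvPolynomial.map_rename, h1]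
    refine MvPolynomial.irreducible_aeval_inr_mul_rename_inl_sub_C ?_ ?_ hsf ?_
    · rw [MvPolynomial.totalDegree, MvPolynomial.support_map_of_injective _
          (algebraMap F (AlgebraicClosure F)).injective, ← MvPolynomial.totalDegree,
        MvPolynomial.totalDegree_add_eq_right_of_totalDegree_lt
          (by rwa [MvPolynomial.totalDegree_C])]
      exact hf.ne'
    · rw [Polynomial.natDegree_map]
      exact hg.ne'
    · exact (map_ne_zero _).2 hg1
  · simp [heval, MvPolynomial.eval_rename, Function.comp_def, hx]
  · have hpd : MvPolynomial.pderiv (Sum.inr ())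
        (MvPolynomial.rename (Sum.inl : Fin n → Fin n ⊕ Unit) f) = 0 := by
      classical
      refine MvPolynomial.pderiv_eq_zero_of_notMem_vars fun h => ?_
      simpa using MvPolynomial.vars_rename _ _ h
    simpa [hpd, heval, MvPolynomial.eval_rename, Function.comp_def, hx] using hg1'
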